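/- In the c-free Fock model, let 𝒜₁, 𝒜₂ be unital subalgebras of the bounded operators on ℋ that are free with respect to the vector state a ↦ ⟨aω, ω⟩, and let η₁, η₂ ∈ ℓ²(J) be orthogonal unit vectors. Then the unital subalgebras 𝔄₁ and 𝔄₂ of the bounded operators on E generated by π(𝒜₁) ∪ 𝒟(η₁) and by π(𝒜₂) ∪ 𝒟(η₂), respectively, are c-free with respect to the pair of states (φ, ψ). -/

import Mathlib

noncomputable section
open scoped ComplexInnerProductSpace ENNReal
open PowerSeries

/-- Unital subalgebras `A₁, A₂` of a unital associative `ℂ`-algebra are *free* with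
respect to a functional `χ` with `χ 1 = 1`: `χ` vanishes on alternating products of
`χ`-centered elements. -/
def IsFreePair {A : Type*} [Ring A] [Algebra ℂ A] (χ : A → ℂ)
    (A₁ A₂ : Subalgebra ℂ A) : Prop :=
  ∀ (n : ℕ) (ε : Fin n → Fin 2) (x : Fin n → A), 0 < n →
    (∀ j, x j ∈ (if ε j = 0 then A₁ else A₂)) →
    (∀ (j : ℕ) (h : j + 1 < n), ε ⟨j, Nat.lt_of_succ_lt h⟩ ≠ ε ⟨j + 1, h⟩) →
    (∀ j, χ (x j) = 0) →
    χ (List.ofFn x).prod = 0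

/-- Unital subalgebras `A₁, A₂` are *c-free* with respect to the pair `(φ, ψ)`:
they are free with respect to `ψ`, and `φ` is multiplicative on alternating products
of `ψ`-centered elements. -/
def IsCFreePair {A : Type*} [Ring A] [Algebra ℂ A] (φ ψ : A → ℂ)
    (A₁ A₂ : Subalgebra ℂ A) : Prop :=
  IsFreePair ψ A₁ A₂ ∧
  ∀ (n : ℕ) (ε : Fin n → Fin 2) (x : Fin n → A), 0 < n →
    (∀ j, x j ∈ (if ε j = 0 then A₁ else A₂)) →
    (∀ (j : ℕ) (h : j + 1 < n), ε ⟨j, Nat.lt_of_succ_lt h⟩ ≠ ε ⟨j + 1, h⟩) →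
    (∀ j, ψ (x j) = 0) →
    φ (List.ofFn x).prod = ∏ j, φ (x j)

/-- The Hilbert space `E = ℋ ⊕ ℓ²(List J; ℋ)` of the c-free Fock model. -/
abbrev FockE (H : Type*) [NormedAddCommGroup H] [InnerProductSpace ℂ H]
    (J : Type*) : Type _ :=
  WithLp 2 (H × lp (fun _ : List J => H) 2)

section FockModel

variable {H : Type*} [NormedAddCommGroup H] [InnerProductSpace ℂ H]
variable {J : Type*} [DecidableEq J]

/-- The first (ℋ-)component of an element of `E`. -/
def efst (ζ : FockE H J) : H := (WithLp.equiv 2 _ ζ).1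

/-- The second component of an element of `E`, as an ℋ-valued function on words. -/
def esnd (ζ : FockE H J) (w : List J) : H :=
  ((WithLp.equiv 2 _ ζ).2 : ∀ _ : List J, H) w

/-- The distinguished unit vector `Ω = (0, δ_[]·ω)` of `E`. -/
def fockOmega (J : Type*) [DecidableEq J] {H : Type*} [NormedAddCommGroup H]
    [InnerProductSpace ℂ H] (ω : H) : FockE H J :=
  (WithLp.equiv 2 _).symm (0, lp.single 2 ([] : List J) ω)

/-- The unit vector `e_ω = (ω, 0)` of `E`. -/
def fockEOmega (J : Type*) [DecidableEq J] {H : Type*} [NormedAddCommGroup H]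
    [InnerProductSpace ℂ H] (ω : H) : FockE H J :=
  (WithLp.equiv 2 _).symm (ω, 0)

/-- The state `φ(T) = ⟨TΩ, Ω⟩` (inner product ℂ-linear in the first argument, i.e.
`⟪Ω, TΩ⟫` in Mathlib's convention). -/
def fockPhi (J : Type*) [DecidableEq J] {H : Type*} [NormedAddCommGroup H]
    [InnerProductSpace ℂ H] (ω : H) (T : FockE H J →L[ℂ] FockE H J) : ℂ :=
  ⟪fockOmega J ω, T (fockOmega J ω)⟫

/-- The state `ψ(T) = ⟨T e_ω, e_ω⟩`. -/
def fockPsi (J : Type*) [DecidableEq J] {H : Type*} [NormedAddCommGroup H]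
    [InnerProductSpace ℂ H] (ω : H) (T : FockE H J →L[ℂ] FockE H J) : ℂ :=
  ⟪fockEOmega J ω, T (fockEOmega J ω)⟫

/-- `P` is the orthogonal projection `P_Ω` onto `ℂΩ`. -/
def IsProjOmega (ω : H) (P : FockE H J →L[ℂ] FockE H J) : Prop :=
  ∀ ζ : FockE H J, P ζ = ⟪fockOmega J ω, ζ⟫ • fockOmega J ω

/-- `x` is the image `π(a)` of a bounded operator `a` on ℋ under the embedding `π`:
`π(a)(h, F) = (a h', w ↦ a (F' w))` where `(h', F') = (h, F) − ⟨(h,F), Ω⟩·Ω`. -/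
def IsEmbed (ω : H) (a : H →L[ℂ] H) (x : FockE H J →L[ℂ] FockE H J) : Prop :=
  ∀ ζ : FockE H J,
    efst (x ζ) = a (efst (ζ - ⟪fockOmega J ω, ζ⟫ • fockOmega J ω)) ∧
    ∀ w : List J,
      esnd (x ζ) w = a (esnd (ζ - ⟪fockOmega J ω, ζ⟫ • fockOmega J ω) w)

/-- `T` is the creation-type operator `A*_η`: `A*_η(h, F) = (0, G)` with `G [] = 0` and
`G (j :: w) = η j · ⟨F w, ω⟩ · ω`. -/
def IsCre (ω : H) (η : lp (fun _ : J => ℂ) 2) (T : FockE H J →L[ℂ] FockE H J) : Prop :=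
  ∀ ζ : FockE H J, efst (T ζ) = 0 ∧ esnd (T ζ) ([] : List J) = 0 ∧
    ∀ (j : J) (w : List J), esnd (T ζ) (j :: w) = η j • (⟪ω, esnd ζ w⟫ • ω)

/-- `ξ` is the vector `ξ_{η,n} = (0, F_n)`, where `F_n w = η(w₁)⋯η(w_n)·ω` on words of
length `n` and `F_n w = 0` otherwise.  (For `n = 0` this is exactly `Ω`.) -/
def IsXi (ω : H) (η : lp (fun _ : J => ℂ) 2) (n : ℕ) (ξ : FockE H J) : Prop :=
  efst ξ = 0 ∧ ∀ w : List J,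
    esnd ξ w = if w.length = n then (w.map fun j => η j).prod • ω else 0

/-- `T` is the annihilation-type operator `A_{η,n}`: the rank-one operator with
`T ξ_{η,n} = Ω` and `T ζ = 0` for `ζ ⊥ ξ_{η,n}`, i.e. `T ζ = ⟨ζ, ξ_{η,n}⟩·Ω`.
For `n = 0` this is exactly the projection `P_Ω`, as required. -/
def IsAnn (ω : H) (η : lp (fun _ : J => ℂ) 2) (n : ℕ)
    (T : FockE H J →L[ℂ] FockE H J) : Prop :=
  ∃ ξ : FockE H J, IsXi ω η n ξ ∧ ∀ ζ : FockE H J, T ζ = ⟪ξ, ζ⟫ • fockOmega J ω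

end FockModel

section FockVectors

variable {H : Type*} [NormedAddCommGroup H] [InnerProductSpace ℂ H]
variable {J : Type*}

/-- Coefficients of the elementary tensor `η_{u₁} ⊗ ⋯ ⊗ η_{u_n}`. -/
def wcoef (η : Fin 2 → lp (fun _ : J => ℂ) 2) : List (Fin 2) → List J → ℂ
  | [], [] => 1
  | i :: u, j :: w => η i j * wcoef η u w
  | [], _ :: _ => 0
  | _ :: _, [] => 0

lemma hasSum_list_of_cons {f : List J → ℂ} (h0 : f [] = 0) {s : ℂ}
    (h : HasSum (fun p : J × List J => f (p.1 :: p.2)) s) : HasSum f s := by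
  have hinj : Function.Injective (fun p : J × List J => p.1 :: p.2) := by
    rintro ⟨a, b⟩ ⟨c, d⟩ h
    simpa using h
  refine (hinj.hasSum_iff ?_).1 h
  intro w hw
  cases w with
  | nil => exact h0
  | cons j w => exact absurd ⟨(j, w), rfl⟩ hw

lemma hasSum_wcoef (η : Fin 2 → lp (fun _ : J => ℂ) 2) (hη : Orthonormal ℂ η)
    (u v : List (Fin 2)) : HasSum (fun w => star (wcoef η u w) * wcoef η v w)
      (if u = v then (1 : ℂ) else 0) := by
  induction u generalizing v with
  | nil =>
    cases v with
    | nil =>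
      have := hasSum_single (f := fun w => star (wcoef η [] w) * wcoef η [] w) ([] : List J)
        (by
          intro w hw
          cases w with
          | nil => exact absurd rfl hw
          | cons j w => simp [wcoef])
      simpa [wcoef] using this
    | cons i v =>
      have : (fun w => star (wcoef η [] w) * wcoef η (i :: v) w) = fun _ => 0 := by
        funext w
        cases w <;> simp [wcoef]
      rw [this]
      simp [hasSum_zero]
  | cons i u ih =>
    cases v with
    | nil =>
      have : (fun w => star (wcoef η (i :: u) w) * wcoef η [] w) = fun _ => 0 := by
        funext w
        cases w <;> simp [wcoef]
      rw [this]
      simp [hasSum_zero]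
    | cons k v =>
      apply hasSum_list_of_cons
      · simp [wcoef]
      have h1 : HasSum (fun j => ⟪η i j, η k j⟫) ⟪η i, η k⟫ := lp.hasSum_inner (η i) (η k)
      rw [orthonormal_iff_ite.1 hη i k] at h1
      have h2 := ih v
      have h4 : Summable fun p : J × List J => ⟪η i p.1, η k p.1⟫ *
            (star (wcoef η u p.2) * wcoef η v p.2) :=
        summable_mul_of_summable_norm (R := ℂ) (f := fun j => ⟪η i j, η k j⟫)
          (g := fun w => star (wcoef η u w) * wcoef η v w)
          h1.summable.norm h2.summable.norm
      have h3 := HasSum.mul h1 h2 h4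
      have e1 : (fun p : J × List J => star (wcoef η (i :: u) (p.1 :: p.2)) *
          wcoef η (k :: v) (p.1 :: p.2)) = fun p : J × List J => ⟪η i p.1, η k p.1⟫ *
            (star (wcoef η u p.2) * wcoef η v p.2) := by
        funext p
        simp only [wcoef, RCLike.inner_apply, star_mul, starRingEnd_apply]
        ring
      have e2 : (if i :: u = k :: v then (1 : ℂ) else 0) =
          (if i = k then (1 : ℂ) else 0) * (if u = v then (1 : ℂ) else 0) := by
        by_cases hik : i = k <;> simp [hik]
      rw [e1, e2]
      exact h3

lemma memlp_wcoef (η : Fin 2 → lp (fun _ : J => ℂ) 2) (hη : Orthonormal ℂ η)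
    (u : List (Fin 2)) (h : H) : Memℓp (fun w : List J => wcoef η u w • h) 2 := by
  apply memℓp_gen
  have h1 := (hasSum_wcoef η hη u u).summable.norm.mul_right (‖h‖ ^ 2)
  refine h1.congr ?_
  intro w
  simp only [norm_smul, norm_mul, norm_star]
  norm_num
  ring

/-- The vector `(0, η_{u₁} ⊗ ⋯ ⊗ η_{u_n} ⊗ h)`. -/
def tvec (η : Fin 2 → lp (fun _ : J => ℂ) 2) (hη : Orthonormal ℂ η)
    (u : List (Fin 2)) : H →ₗ[ℂ] FockE H J where
  toFun h := (WithLp.equiv 2 _).symm (0, ⟨fun w => wcoef η u w • h, memlp_wcoef η hη u h⟩)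
  map_add' h k := by
    apply (WithLp.equiv 2 _).injective
    refine Prod.ext ?_ ?_
    · simp
    · ext w
      exact smul_add _ _ _
  map_smul' c h := by
    apply (WithLp.equiv 2 _).injective
    refine Prod.ext ?_ ?_
    · simp
    · ext w
      exact smul_comm _ _ _

/-- The vector `(h, 0)`. -/
def ivec (J : Type*) (h : H) : FockE H J := (WithLp.equiv 2 _).symm (h, 0)

/-- The embedding `h ↦ (h, 0)` as a linear map. -/
def ivecL (H : Type*) [NormedAddCommGroup H] [InnerProductSpace ℂ H] (J : Type*) :
    H →ₗ[ℂ] FockE H J where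
  toFun h := ivec J h
  map_add' h k := by
    apply (WithLp.equiv 2 _).injective
    refine Prod.ext rfl ?_
    exact (add_zero (0 : lp (fun _ : List J => H) 2)).symm
  map_smul' c h := by
    apply (WithLp.equiv 2 _).injective
    refine Prod.ext rfl ?_
    exact (smul_zero c).symm

lemma fock_ext {x y : FockE H J} (h1 : efst x = efst y) (h2 : ∀ w, esnd x w = esnd y w) :
    x = y := by
  apply (WithLp.equiv 2 _).injective
  refine Prod.ext h1 ?_
  ext w
  exact h2 w

lemma fock_inner (x y : FockE H J) (s : ℂ)
    (h : HasSum (fun w => ⟪esnd x w, esnd y w⟫) s) :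
    ⟪x, y⟫ = ⟪efst x, efst y⟫ + s := by
  rw [WithLp.prod_inner_apply]
  congr 1
  exact (lp.hasSum_inner (𝕜 := ℂ) _ _).unique h

variable (η : Fin 2 → lp (fun _ : J => ℂ) 2) (hη : Orthonormal ℂ η)

@[simp] lemma efst_tvec (u : List (Fin 2)) (h : H) : efst (tvec η hη u h) = 0 := rfl
@[simp] lemma esnd_tvec (u : List (Fin 2)) (h : H) (w : List J) :
    esnd (tvec η hη u h) w = wcoef η u w • h := rfl
@[simp] lemma efst_ivec (h : H) : efst (ivec J h) = h := rfl
@[simp] lemma esnd_ivec (h : H) (w : List J) : esnd (ivec J h) w = 0 := rfl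
@[simp] lemma efst_sub (x y : FockE H J) : efst (x - y) = efst x - efst y := rfl
@[simp] lemma esnd_sub (x y : FockE H J) (w : List J) :
    esnd (x - y) w = esnd x w - esnd y w := rfl
@[simp] lemma efst_smul (c : ℂ) (x : FockE H J) : efst (c • x) = c • efst x := rfl
@[simp] lemma esnd_smul (c : ℂ) (x : FockE H J) (w : List J) :
    esnd (c • x) w = c • esnd x w := rfl
@[simp] lemma efst_zero : efst (0 : FockE H J) = 0 := rfl
@[simp] lemma esnd_zero (w : List J) : esnd (0 : FockE H J) w = 0 := rfl

lemma inner_tvec (u v : List (Fin 2)) (h k : H) :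
    ⟪tvec η hη u h, tvec η hη v k⟫ = if u = v then ⟪h, k⟫ else 0 := by
  have h1 := (hasSum_wcoef η hη u v).mul_right ⟪h, k⟫
  rw [fock_inner _ _ ((if u = v then 1 else 0) * ⟪h, k⟫)]
  · simp
  · refine h1.congr_fun ?_
    intro w
    simp only [esnd_tvec, inner_smul_left, inner_smul_right, starRingEnd_apply]
    ring

lemma inner_tvec_ivec (u : List (Fin 2)) (h k : H) :
    ⟪tvec η hη u h, ivec J k⟫ = 0 := by
  rw [fock_inner _ _ 0]
  · simp
  · simp [hasSum_zero]

lemma inner_ivec (h k : H) : ⟪ivec J h, ivec J k⟫ = ⟪h, k⟫ := by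
  rw [fock_inner _ _ 0]
  · simp
  · simp [hasSum_zero]

lemma wcoef_replicate (i : Fin 2) : ∀ (n : ℕ) (w : List J),
    wcoef η (List.replicate n i) w = if w.length = n then (w.map fun j => η i j).prod else 0
  | 0, [] => by simp [wcoef]
  | 0, j :: w => by simp [wcoef]
  | n + 1, [] => by simp [wcoef, List.replicate_succ]
  | n + 1, j :: w => by simp [wcoef, List.replicate_succ, wcoef_replicate i n w]

lemma cre_ivec {ω : H} {i : Fin 2} {x : FockE H J →L[ℂ] FockE H J}
    (hx : IsCre ω (η i) x) (h : H) : x (ivec J h) = 0 := by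
  obtain ⟨h1, h2, h3⟩ := hx (ivec J h)
  apply fock_ext
  · simpa using h1
  · intro w
    cases w with
    | nil => simpa using h2
    | cons j w => simpa using h3 j w

lemma cre_tvec {ω : H} {i : Fin 2} {x : FockE H J →L[ℂ] FockE H J}
    (hx : IsCre ω (η i) x) (u : List (Fin 2)) (h : H) :
    x (tvec η hη u h) = ⟪ω, h⟫ • tvec η hη (i :: u) ω := by
  obtain ⟨h1, h2, h3⟩ := hx (tvec η hη u h)
  apply fock_ext
  · simpa using h1
  · intro w
    cases w with
    | nil => simpa [wcoef] using h2
    | cons j w =>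
      rw [h3 j w]
      simp [wcoef, smul_smul]
      congr 1
      ring

variable [DecidableEq J]

lemma fockOmega_eq (ω : H) : fockOmega J ω = tvec η hη [] ω := by
  apply fock_ext
  · rfl
  · intro w
    cases w with
    | nil => simp [fockOmega, esnd, tvec, wcoef]
    | cons j w => simp [fockOmega, esnd, tvec, wcoef]

lemma embed_ivec {ω : H} {a : H →L[ℂ] H} {x : FockE H J →L[ℂ] FockE H J}
    (hx : IsEmbed ω a x) (h : H) : x (ivec J h) = ivec J (a h) := by
  have h0 : ⟪fockOmega J ω, ivec J h⟫ = 0 := by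
    rw [fock_inner _ _ 0]
    · simp [fockOmega, efst]
    · simp [hasSum_zero]
  obtain ⟨h1, h2⟩ := hx (ivec J h)
  rw [h0] at h1 h2
  apply fock_ext
  · simpa using h1
  · intro w
    simpa using h2 w

lemma embed_tvec {ω : H} {a : H →L[ℂ] H} {x : FockE H J →L[ℂ] FockE H J}
    (hx : IsEmbed ω a x) (u : List (Fin 2)) (hu : u ≠ []) (h : H) :
    x (tvec η hη u h) = tvec η hη u (a h) := by
  have h0 : ⟪fockOmega J ω, tvec η hη u h⟫ = 0 := by
    rw [fockOmega_eq η hη, inner_tvec, if_neg hu.symm]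
  obtain ⟨h1, h2⟩ := hx (tvec η hη u h)
  rw [h0] at h1 h2
  apply fock_ext
  · simpa using h1
  · intro w
    simpa using h2 w

lemma embed_omega {ω : H} (hω : ⟪ω, ω⟫ = 1) {a : H →L[ℂ] H} {x : FockE H J →L[ℂ] FockE H J}
    (hx : IsEmbed ω a x) :
    x (tvec η hη [] ω) = 0 := by
  have h0 : ⟪fockOmega J ω, tvec η hη [] ω⟫ = 1 := by
    rw [fockOmega_eq η hη, inner_tvec, if_pos rfl, hω]
  obtain ⟨h1, h2⟩ := hx (tvec η hη [] ω)
  rw [h0, ← fockOmega_eq η hη] at h1 h2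
  rw [← fockOmega_eq η hη]
  apply fock_ext
  · simpa using h1
  · intro w
    simpa using h2 w

lemma ann_apply {ω : H} {i : Fin 2} {n : ℕ} {x : FockE H J →L[ℂ] FockE H J}
    (hx : IsAnn ω (η i) n x) (ζ : FockE H J) :
    x ζ = ⟪tvec η hη (List.replicate n i) ω, ζ⟫ • tvec η hη [] ω := by
  obtain ⟨ξ, ⟨h1, h2⟩, h3⟩ := hx
  have : ξ = tvec η hη (List.replicate n i) ω := by
    apply fock_ext
    · simpa using h1
    · intro w
      rw [h2 w, esnd_tvec, wcoef_replicate]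
      split_ifs <;> simp
  rw [h3, this, fockOmega_eq η hη]

end FockVectors

section Algebraic

variable {H : Type*} [NormedAddCommGroup H] [InnerProductSpace ℂ H]
variable {E : Type*} [NormedAddCommGroup E] [InnerProductSpace ℂ E]

/-- List form of freeness for a pair of algebras indexed by `Fin 2`. -/
def ListFree (ω : H) (A : Fin 2 → Subalgebra ℂ (H →L[ℂ] H)) : Prop :=
  ∀ l : List (Fin 2 × (H →L[ℂ] H)), l ≠ [] → (l.map Prod.fst).IsChain (· ≠ ·) →
    (∀ p ∈ l, p.2 ∈ A p.1 ∧ ⟪ω, p.2 ω⟫ = 0) → ⟪ω, (l.map Prod.snd).prod ω⟫ = 0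

lemma listFree_of_isFreePair (ω : H) (A₁ A₂ : Subalgebra ℂ (H →L[ℂ] H))
    (hfree : IsFreePair (fun a => ⟪ω, a ω⟫) A₁ A₂) :
    ListFree ω (fun i => if i = 0 then A₁ else A₂) := by
  intro l hl hc hp
  have h := hfree l.length (fun j => (l.get j).1) (fun j => (l.get j).2)
    (List.length_pos_iff.2 hl) (fun j => (hp _ (List.get_mem l j)).1) ?_
    (fun j => (hp _ (List.get_mem l j)).2)
  · have e : List.ofFn (fun j => (l.get j).2) = l.map Prod.snd := by
      rw [show (fun j => (l.get j).2) = Prod.snd ∘ l.get from rfl, ← List.map_ofFn, List.ofFn_get]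
    rw [e] at h
    exact h
  · intro j hj
    have := (List.isChain_iff_getElem.1 hc) j (by simpa using hj)
    simpa using this

/-- Vectors `b₁ ⋯ b_r a ω` with `b_j` centered, alternating, `a ∈ A k`, and leading index `i`. -/
def VV (ω : H) (A : Fin 2 → Subalgebra ℂ (H →L[ℂ] H)) (i k : Fin 2) (h : H) : Prop :=
  ∃ (l : List (Fin 2 × (H →L[ℂ] H))) (a : H →L[ℂ] H), a ∈ A k ∧
    (∀ p ∈ l, p.2 ∈ A p.1 ∧ ⟪ω, p.2 ω⟫ = 0) ∧
    (l.map Prod.fst ++ [k]).IsChain (· ≠ ·) ∧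
    (l.map Prod.fst ++ [k]).head? = some i ∧ h = (l.map Prod.snd).prod (a ω)

variable {ω : H} {A : Fin 2 → Subalgebra ℂ (H →L[ℂ] H)}

lemma VV.base {k : Fin 2} {a : H →L[ℂ] H} (ha : a ∈ A k) : VV ω A k k (a ω) :=
  ⟨[], a, ha, by simp, by simp, by simp, by simp⟩

lemma VV.step {i j k : Fin 2} {h : H} (hV : VV ω A i k h) {b : H →L[ℂ] H} (hb : b ∈ A j)
    (hb0 : ⟪ω, b ω⟫ = 0) (hij : i ≠ j) : VV ω A j k (b h) := by
  obtain ⟨l, a, ha, hl, hc, hh, rfl⟩ := hV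
  refine ⟨(j, b) :: l, a, ha, ?_, ?_, by simp, by simp⟩
  · intro p hp
    rcases List.mem_cons.1 hp with rfl | hp
    · exact ⟨hb, hb0⟩
    · exact hl p hp
  · rw [List.map_cons, List.cons_append, List.isChain_cons]
    refine ⟨?_, hc⟩
    intro y hy
    rw [hh] at hy
    simp at hy
    subst hy
    exact hij.symm

lemma VV.ortho (hω : ⟪ω, ω⟫ = 1) (hF : ListFree ω A) {i k : Fin 2} {h : H}
    (hV : VV ω A i k h) (hik : i ≠ k)
    {b : H →L[ℂ] H} (hb : b ∈ A k) : ⟪ω, b h⟫ = 0 := by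
  obtain ⟨l, a, ha, hl, hc, hh, rfl⟩ := hV
  have hne : l ≠ [] := by
    rintro rfl
    simp at hh
    exact hik hh.symm
  have hcen : ∀ c ∈ A k, (c - ⟪ω, c ω⟫ • (1 : H →L[ℂ] H)) ∈ A k ∧
      ⟪ω, (c - ⟪ω, c ω⟫ • (1 : H →L[ℂ] H)) ω⟫ = 0 := by
    intro c hc
    refine ⟨sub_mem hc (Subalgebra.smul_mem _ (one_mem _) _), ?_⟩
    rw [sub_apply, inner_sub_right, smul_apply, one_apply_eq_self,
      inner_smul_right, hω, mul_one, sub_self]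
  have hcc : (k :: (l.map Prod.fst ++ [k])).IsChain (· ≠ ·) := by
    rw [List.isChain_cons]
    refine ⟨?_, hc⟩
    intro y hy
    rw [hh] at hy
    simp at hy
    subst hy
    exact hik.symm
  set α := ⟪ω, a ω⟫ with hα
  set β := ⟪ω, b ω⟫ with hβ
  set a0 := a - α • (1 : H →L[ℂ] H) with ha0
  set b0 := b - β • (1 : H →L[ℂ] H) with hb0
  have pa := hcen a ha
  have pb := hcen b hb
  rw [← hα, ← ha0] at pa
  rw [← hβ, ← hb0] at pb
  have e1 := hF l hne hc.left_of_append hl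
  have e2 := hF ((k, b0) :: l) (by simp)
    (by
      rw [List.map_cons]
      exact List.IsChain.left_of_append (l₂ := [k]) (by simpa using hcc))
    (by
      intro p hp
      rcases List.mem_cons.1 hp with rfl | hp
      · exact pb
      · exact hl p hp)
  have e3 := hF (l ++ [(k, a0)]) (by simp) (by simpa using hc)
    (by
      intro p hp
      rcases List.mem_append.1 hp with hp | hp
      · exact hl p hp
      · rw [List.mem_singleton.1 hp]
        exact pa)
  have e4 := hF ((k, b0) :: (l ++ [(k, a0)])) (by simp) (by simpa using hcc)
    (by
      intro p hp
      rcases List.mem_cons.1 hp with rfl | hp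
      · exact pb
      rcases List.mem_append.1 hp with hp | hp
      · exact hl p hp
      · rw [List.mem_singleton.1 hp]
        exact pa)
  have hbe : b = b0 + β • (1 : H →L[ℂ] H) := by rw [hb0]; abel
  have hae : a = a0 + α • (1 : H →L[ℂ] H) := by rw [ha0]; abel
  simp only [List.map_cons, List.map_append, List.prod_cons, List.prod_append, List.map_nil,
    List.prod_nil, mul_one, mul_apply_eq_comp] at e1 e2 e3 e4
  rw [hbe, hae]
  simp only [add_apply, smul_apply,
    one_apply_eq_self, map_add, map_smul, inner_add_right, inner_smul_right,
    e1, e2, e3, e4, smul_add]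
  simp

/-- The relations between the operators and the vectors of the model that the proof uses. -/
structure Model (ω : H) (t : List (Fin 2) → H →ₗ[ℂ] E) (ι : H →ₗ[ℂ] E)
    (Pi : (H →L[ℂ] H) → (E →L[ℂ] E)) (C : Fin 2 → (E →L[ℂ] E))
    (An : Fin 2 → ℕ → (E →L[ℂ] E)) : Prop where
  hω : ⟪ω, ω⟫ = 1
  inner_t : ∀ u v h k, ⟪t u h, t v k⟫ = if u = v then ⟪h, k⟫ else 0
  inner_i : ∀ h k, ⟪ι h, ι k⟫ = ⟪h, k⟫
  pi_i : ∀ a h, Pi a (ι h) = ι (a h)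
  pi_t : ∀ a u h, u ≠ [] → Pi a (t u h) = t u (a h)
  pi_Ω : ∀ a, Pi a (t [] ω) = 0
  c_i : ∀ i h, C i (ι h) = 0
  c_t : ∀ i u h, C i (t u h) = ⟪ω, h⟫ • t (i :: u) ω
  an_i : ∀ i n h, An i n (ι h) = 0
  an_t : ∀ i n u h, An i n (t u h) =
    if List.replicate n i = u then ⟪ω, h⟫ • t [] ω else 0

/-- The span of vectors on mixed words. -/
def Dead (t : List (Fin 2) → H →ₗ[ℂ] E) : Submodule ℂ E :=
  Submodule.span ℂ {x | ∃ u h, (0 : Fin 2) ∈ u ∧ (1 : Fin 2) ∈ u ∧ x = t u h}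

/-- The cyclic space of `Ω` under the `i`-th algebra. -/
def KK (ω : H) (A : Fin 2 → Subalgebra ℂ (H →L[ℂ] H)) (t : List (Fin 2) → H →ₗ[ℂ] E)
    (i : Fin 2) : Submodule ℂ E :=
  Submodule.span ℂ ({t [] ω} ∪
    {x | ∃ a ∈ A i, ∃ m : ℕ, x = t (List.replicate (m + 1) i) (a ω)})

/-- The space containing the non-vacuum part after an operator with index `i` has acted. -/
def LL (ω : H) (A : Fin 2 → Subalgebra ℂ (H →L[ℂ] H)) (t : List (Fin 2) → H →ₗ[ℂ] E)
    (i : Fin 2) : Submodule ℂ E :=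
  Dead t ⊔ Submodule.span ℂ
    {x | ∃ (k : Fin 2) (m : ℕ) (h : H), VV ω A i k h ∧ x = t (List.replicate (m + 1) k) h}

/-- `T` behaves like an element of the `i`-th algebra with symbol `a`. -/
structure Good (ω : H) (A : Fin 2 → Subalgebra ℂ (H →L[ℂ] H)) (t : List (Fin 2) → H →ₗ[ℂ] E)
    (ι : H →ₗ[ℂ] E) (i : Fin 2) (T : E →L[ℂ] E) (a : H →L[ℂ] H) : Prop where
  ha : a ∈ A i
  h1 : ∀ h, T (ι h) = ι (a h)
  hA : ∀ m h, (∀ b ∈ A i, ⟪ω, b h⟫ = 0) →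
    T (t (List.replicate (m + 1) i) h) = t (List.replicate (m + 1) i) (a h)
  hB : ∀ k, k ≠ i → ∀ m h,
    T (t (List.replicate (m + 1) k) h) - t (List.replicate (m + 1) k) (a h) ∈ Dead t
  hD : ∀ x ∈ Dead t, T x ∈ Dead t
  hK : ∀ x ∈ KK ω A t i, T x ∈ KK ω A t i

variable {t : List (Fin 2) → H →ₗ[ℂ] E} {ι : H →ₗ[ℂ] E}
  {Pi : (H →L[ℂ] H) → (E →L[ℂ] E)} {C : Fin 2 → (E →L[ℂ] E)}
  {An : Fin 2 → ℕ → (E →L[ℂ] E)}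

lemma mem_dead {u : List (Fin 2)} (h : H) (h0 : (0 : Fin 2) ∈ u) (h1 : (1 : Fin 2) ∈ u) :
    t u h ∈ Dead t := Submodule.subset_span ⟨u, h, h0, h1, rfl⟩

lemma span_invariant {S : Set E} {W : Submodule ℂ E} (T : E →L[ℂ] E)
    (h : ∀ x ∈ S, T x ∈ W) : ∀ x ∈ Submodule.span ℂ S, T x ∈ W := by
  intro x hx
  have : Submodule.span ℂ S ≤ W.comap (T : E →ₗ[ℂ] E) := Submodule.span_le.2 h
  exact this hx

lemma omega_mem_KK (i : Fin 2) : t [] ω ∈ KK ω A t i := Submodule.subset_span (Or.inl rfl)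

lemma vec_mem_KK (i : Fin 2) (m : ℕ) {a : H →L[ℂ] H} (ha : a ∈ A i) :
    t (List.replicate (m + 1) i) (a ω) ∈ KK ω A t i :=
  Submodule.subset_span (Or.inr ⟨a, ha, m, rfl⟩)

lemma good_pi (M : Model ω t ι Pi C An) {i : Fin 2} {a : H →L[ℂ] H} (ha : a ∈ A i) :
    Good ω A t ι i (Pi a) a where
  ha := ha
  h1 := M.pi_i a
  hA m h _ := M.pi_t a _ h (by simp)
  hB k _ m h := by rw [M.pi_t a _ h (by simp), sub_self]; exact zero_mem _
  hD := by
    apply span_invariant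
    rintro _ ⟨u, h, h0, h1, rfl⟩
    rw [M.pi_t a u h (List.ne_nil_of_mem h0)]
    exact mem_dead _ h0 h1
  hK := by
    apply span_invariant
    rintro _ (rfl | ⟨b, hb, m, rfl⟩)
    · rw [M.pi_Ω]; exact zero_mem _
    · rw [M.pi_t a _ _ (by simp)]
      exact vec_mem_KK i m (a := a * b) (mul_mem ha hb)

lemma good_c (M : Model ω t ι Pi C An) (i : Fin 2) : Good ω A t ι i (C i) 0 where
  ha := zero_mem _
  h1 h := by simp [M.c_i]
  hA m h hh := by
    have := hh 1 (one_mem _)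
    rw [one_apply_eq_self] at this
    simp [M.c_t, this]
  hB k hk m h := by
    rw [M.c_t]
    simp only [zero_apply, map_zero, sub_zero]
    apply Submodule.smul_mem
    apply mem_dead
    all_goals
      simp only [List.mem_cons, List.mem_replicate]
      omega
  hD := by
    apply span_invariant
    rintro _ ⟨u, h, h0, h1, rfl⟩
    rw [M.c_t]
    exact Submodule.smul_mem _ _ (mem_dead _ (List.mem_cons_of_mem _ h0)
      (List.mem_cons_of_mem _ h1))
  hK := by
    apply span_invariant
    rintro _ (rfl | ⟨b, hb, m, rfl⟩)
    · rw [M.c_t]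
      exact Submodule.smul_mem _ _ (vec_mem_KK i 0 (a := 1) (one_mem _))
    · rw [M.c_t]
      exact Submodule.smul_mem _ _ (vec_mem_KK i (m + 1) (a := 1) (one_mem _))

lemma good_an (M : Model ω t ι Pi C An) (i : Fin 2) (n : ℕ) :
    Good ω A t ι i (An i n) 0 where
  ha := zero_mem _
  h1 h := by simp [M.an_i]
  hA m h hh := by
    have := hh 1 (one_mem _)
    rw [one_apply_eq_self] at this
    simp [M.an_t, this]
  hB k hk m h := by
    rw [M.an_t, if_neg]
    · simp
    · intro he
      have : k ∈ List.replicate n i := by rw [he]; simp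
      exact hk (List.eq_of_mem_replicate this)
  hD := by
    apply span_invariant
    rintro _ ⟨u, h, h0, h1, rfl⟩
    rw [M.an_t, if_neg]
    · exact zero_mem _
    · rintro rfl
      have := (List.eq_of_mem_replicate h0).trans (List.eq_of_mem_replicate h1).symm
      simp at this
  hK := by
    apply span_invariant
    rintro _ (rfl | ⟨b, hb, m, rfl⟩)
    all_goals
      rw [M.an_t]
      split_ifs
      · exact Submodule.smul_mem _ _ (omega_mem_KK i)
      · exact zero_mem _

lemma good_algebraMap (i : Fin 2) (r : ℂ) :
    Good ω A t ι i (algebraMap ℂ (E →L[ℂ] E) r) (algebraMap ℂ (H →L[ℂ] H) r) where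
  ha := Subalgebra.algebraMap_mem _ _
  h1 h := by simp [Algebra.algebraMap_eq_smul_one]
  hA m h _ := by simp [Algebra.algebraMap_eq_smul_one]
  hB k _ m h := by simp [Algebra.algebraMap_eq_smul_one]
  hD x hx := by simpa [Algebra.algebraMap_eq_smul_one] using Submodule.smul_mem _ r hx
  hK x hx := by simpa [Algebra.algebraMap_eq_smul_one] using Submodule.smul_mem _ r hx

lemma Good.add {i : Fin 2} {S T : E →L[ℂ] E} {a b : H →L[ℂ] H} (hS : Good ω A t ι i S a)
    (hT : Good ω A t ι i T b) : Good ω A t ι i (S + T) (a + b) where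
  ha := add_mem hS.ha hT.ha
  h1 h := by simp [hS.h1, hT.h1]
  hA m h hh := by simp [hS.hA m h hh, hT.hA m h hh]
  hB k hk m h := by
    have := add_mem (hS.hB k hk m h) (hT.hB k hk m h)
    simp only [add_apply, map_add]
    convert this using 1
    abel
  hD x hx := add_mem (hS.hD x hx) (hT.hD x hx)
  hK x hx := add_mem (hS.hK x hx) (hT.hK x hx)

lemma Good.mul {i : Fin 2} {S T : E →L[ℂ] E} {a b : H →L[ℂ] H} (hS : Good ω A t ι i S a)
    (hT : Good ω A t ι i T b) : Good ω A t ι i (S * T) (a * b) where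
  ha := mul_mem hS.ha hT.ha
  h1 h := by simp [hS.h1, hT.h1]
  hA m h hh := by
    rw [mul_apply_eq_comp, hT.hA m h hh, hS.hA m (b h)]
    · rfl
    · intro c hc
      exact hh (c * b) (mul_mem hc hT.ha)
  hB k hk m h := by
    have := add_mem (hS.hD _ (hT.hB k hk m h)) (hS.hB k hk m (b h))
    simp only [mul_apply_eq_comp]
    convert this using 1
    simp
  hD x hx := hS.hD _ (hT.hD x hx)
  hK x hx := hS.hK _ (hT.hK x hx)

lemma good_of_mem_adjoin (M : Model ω t ι Pi C An) (i : Fin 2) {T : E →L[ℂ] E}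
    (hT : T ∈ Algebra.adjoin ℂ ((Pi '' (A i : Set (H →L[ℂ] H))) ∪
      ({C i} ∪ Set.range (An i)))) : ∃ a, Good ω A t ι i T a := by
  induction hT using Algebra.adjoin_induction with
  | mem x hx =>
    rcases hx with ⟨a, ha, rfl⟩ | rfl | ⟨n, rfl⟩
    · exact ⟨a, good_pi M ha⟩
    · exact ⟨0, good_c M i⟩
    · exact ⟨0, good_an M i n⟩
  | algebraMap r => exact ⟨_, good_algebraMap i r⟩
  | add x y _ _ hx hy =>
    obtain ⟨a, ha⟩ := hx
    obtain ⟨b, hb⟩ := hy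
    exact ⟨_, ha.add hb⟩
  | mul x y _ _ hx hy =>
    obtain ⟨a, ha⟩ := hx
    obtain ⟨b, hb⟩ := hy
    exact ⟨_, ha.mul hb⟩

lemma vec_mem_LL {i k : Fin 2} (m : ℕ) {h : H} (hV : VV ω A i k h) :
    t (List.replicate (m + 1) k) h ∈ LL ω A t i :=
  Submodule.mem_sup_right (Submodule.subset_span ⟨k, m, h, hV, rfl⟩)

lemma LL_step (M : Model ω t ι Pi C An) (hF : ListFree ω A) {i j : Fin 2} (hij : i ≠ j)
    {T : E →L[ℂ] E} {a : H →L[ℂ] H} (hT : Good ω A t ι j T a) (ha0 : ⟪ω, a ω⟫ = 0) :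
    ∀ x ∈ LL ω A t i, T x ∈ LL ω A t j := by
  intro x hx
  obtain ⟨y, hy, z, hz, rfl⟩ := Submodule.mem_sup.1 hx
  rw [map_add]
  refine add_mem (Submodule.mem_sup_left (hT.hD y hy)) ?_
  revert z
  intro z hz _
  revert z
  suffices h : ∀ z ∈ Submodule.span ℂ
      {x | ∃ (k : Fin 2) (m : ℕ) (h : H), VV ω A i k h ∧ x = t (List.replicate (m + 1) k) h},
      T z ∈ LL ω A t j from fun z hz _ => h z hz
  apply span_invariant
  rintro _ ⟨k, m, h, hV, rfl⟩
  have hV' := hV.step hT.ha ha0 hij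
  by_cases hk : k = j
  · subst hk
    rw [hT.hA m h (fun b hb => hV.ortho M.hω hF hij hb)]
    exact vec_mem_LL m hV'
  · have := add_mem (Submodule.mem_sup_left (hT.hB k hk m h)) (vec_mem_LL (t := t) m hV')
    simpa [LL] using this

lemma KK_base (M : Model ω t ι Pi C An) (i : Fin 2) :
    ∀ x ∈ KK ω A t i, x - ⟪t [] ω, x⟫ • t [] ω ∈ LL ω A t i := by
  have := span_invariant (S := ({t [] ω} ∪
    {x | ∃ a ∈ A i, ∃ m : ℕ, x = t (List.replicate (m + 1) i) (a ω)}))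
    (W := LL ω A t i) (1 - (innerSL ℂ (t [] ω)).smulRight (t [] ω)) ?_
  · intro x hx
    simpa using this x hx
  rintro _ (rfl | ⟨b, hb, m, rfl⟩)
  · simp [M.inner_t, M.hω, -inner_self_eq_norm_sq_to_K]
  · have e : ⟪t [] ω, t (List.replicate (m + 1) i) (b ω)⟫ = 0 := by
      rw [M.inner_t, if_neg]
      simp [List.replicate_succ]
    simp only [sub_apply, one_apply_eq_self,
      ContinuousLinearMap.smulRight_apply, innerSL_apply_apply, e, zero_smul, sub_zero]
    exact vec_mem_LL m (VV.base hb)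

lemma LL_ortho (M : Model ω t ι Pi C An) (i : Fin 2) :
    ∀ x ∈ LL ω A t i, ⟪t [] ω, x⟫ = 0 := by
  have key : LL ω A t i ≤ LinearMap.ker (innerSL ℂ (t [] ω) : E →ₗ[ℂ] ℂ) := by
    refine sup_le (Submodule.span_le.2 ?_) (Submodule.span_le.2 ?_)
    · rintro _ ⟨u, h, h0, h1, rfl⟩
      simp [M.inner_t, (List.ne_nil_of_mem h0).symm]
    · rintro _ ⟨k, m, h, hV, rfl⟩
      simp [M.inner_t, List.replicate_succ]
  intro x hx
  simpa using key hx

lemma main_phi (M : Model ω t ι Pi C An) (hF : ListFree ω A) : ∀ (n : ℕ)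
    (ε : Fin (n + 1) → Fin 2) (x : Fin (n + 1) → (E →L[ℂ] E)) (a : Fin (n + 1) → (H →L[ℂ] H)),
    (∀ j, Good ω A t ι (ε j) (x j) (a j)) → (∀ j, ⟪ω, a j ω⟫ = 0) →
    (∀ (j : ℕ) (h : j + 1 < n + 1), ε ⟨j, Nat.lt_of_succ_lt h⟩ ≠ ε ⟨j + 1, h⟩) →
    (List.ofFn x).prod (t [] ω) - (∏ j, ⟪t [] ω, x j (t [] ω)⟫) • t [] ω ∈ LL ω A t (ε 0) := by
  intro n
  induction n with
  | zero =>
    intro ε x a hg h0 hε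
    have := KK_base (A := A) M (ε 0) _ ((hg 0).hK _ (omega_mem_KK _))
    simpa using this
  | succ n ih =>
    intro ε x a hg h0 hε
    have h1 := ih (fun j => ε j.succ) (fun j => x j.succ) (fun j => a j.succ)
      (fun j => hg _) (fun j => h0 _) (fun j hj => hε (j + 1) (Nat.succ_lt_succ hj))
    have h2 := LL_step M hF (hε 0 (by omega)).symm (hg 0) (h0 0) _ h1
    have h3 := KK_base (A := A) M (ε 0) _ ((hg 0).hK _ (omega_mem_KK _))
    have h4 := add_mem h2 (Submodule.smul_mem _ (∏ j : Fin (n + 1),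
      ⟪t [] ω, x j.succ (t [] ω)⟫) h3)
    rw [List.ofFn_succ, List.prod_cons, Fin.prod_univ_succ]
    rw [map_sub, map_smul, smul_sub, smul_smul, sub_add_sub_cancel, mul_comm] at h4
    exact h4

lemma main_psi : ∀ (n : ℕ) (x : Fin n → (E →L[ℂ] E)) (a : Fin n → (H →L[ℂ] H)),
    (∀ j h, x j (ι h) = ι (a j h)) → ∀ h, (List.ofFn x).prod (ι h) = ι ((List.ofFn a).prod h) := by
  intro n
  induction n with
  | zero => intro x a _ h; simp
  | succ n ih =>
    intro x a hx h
    rw [List.ofFn_succ, List.prod_cons, List.ofFn_succ, List.prod_cons]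
    simp only [mul_apply_eq_comp]
    rw [ih (fun j => x j.succ) (fun j => a j.succ) (fun j => hx _), hx]

theorem abstract_cfree (M : Model ω t ι Pi C An) (A₁ A₂ : Subalgebra ℂ (H →L[ℂ] H))
    (hfree : IsFreePair (fun a => ⟪ω, a ω⟫) A₁ A₂) :
    IsCFreePair (fun T : E →L[ℂ] E => ⟪t [] ω, T (t [] ω)⟫) (fun T => ⟪ι ω, T (ι ω)⟫)
      (Algebra.adjoin ℂ ((Pi '' (A₁ : Set (H →L[ℂ] H))) ∪ ({C 0} ∪ Set.range (An 0))))
      (Algebra.adjoin ℂ ((Pi '' (A₂ : Set (H →L[ℂ] H))) ∪ ({C 1} ∪ Set.range (An 1)))) := by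
  have hF := listFree_of_isFreePair ω A₁ A₂ hfree
  set A : Fin 2 → Subalgebra ℂ (H →L[ℂ] H) := fun i => if i = 0 then A₁ else A₂ with hA
  have hgood : ∀ (i : Fin 2) (T : E →L[ℂ] E), T ∈ (if i = 0 then
      (Algebra.adjoin ℂ ((Pi '' (A₁ : Set (H →L[ℂ] H))) ∪ ({C 0} ∪ Set.range (An 0)))) else
      (Algebra.adjoin ℂ ((Pi '' (A₂ : Set (H →L[ℂ] H))) ∪ ({C 1} ∪ Set.range (An 1))))) →
      ∃ a, Good ω A t ι i T a := by
    intro i T hT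
    apply good_of_mem_adjoin M i
    fin_cases i
    · simpa [hA] using hT
    · simpa [hA] using hT
  have hpsi : ∀ (i : Fin 2) (T : E →L[ℂ] E) (a : H →L[ℂ] H), Good ω A t ι i T a →
      ⟪ι ω, T (ι ω)⟫ = ⟪ω, a ω⟫ := by
    intro i T a hg
    rw [hg.h1, M.inner_i]
  refine ⟨?_, ?_⟩
  · intro n ε x hn hx hε h0
    choose a ha using fun j => hgood (ε j) (x j) (hx j)
    have := hfree n ε a hn (fun j => (ha j).ha) hε
      (fun j => (hpsi _ _ _ (ha j)).symm.trans (h0 j))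
    dsimp only
    rw [main_psi n x a (fun j => (ha j).h1), M.inner_i]
    exact this
  · intro n ε x hn hx hε h0
    choose a ha using fun j => hgood (ε j) (x j) (hx j)
    obtain ⟨n, rfl⟩ : ∃ k, n = k + 1 := ⟨n - 1, by omega⟩
    have h1 := LL_ortho M _ _ (main_phi M hF n ε x a ha
      (fun j => (hpsi _ _ _ (ha j)).symm.trans (h0 j)) hε)
    rw [inner_sub_right, inner_smul_right, M.inner_t, if_pos rfl, M.hω, mul_one, sub_eq_zero] at h1
    exact h1

end Algebraic

/-- Theorem 2.4 of the paper: if `A₁, A₂` are free in `L(ℋ)` with respect to the vector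
state `a ↦ ⟨aω, ω⟩` and `η₁ ⊥ η₂` are unit vectors, then the algebras generated by
`π(A₁) ∪ 𝒟(η₁)` and `π(A₂) ∪ 𝒟(η₂)` are c-free with respect to `(φ, ψ)`. -/
theorem cfree_fock_model
    {H : Type*} [NormedAddCommGroup H] [InnerProductSpace ℂ H]
    {J : Type*} [DecidableEq J] (ω : H) (hω : ‖ω‖ = 1)
    (η₁ η₂ : lp (fun _ : J => ℂ) 2) (hη₁ : ‖η₁‖ = 1) (hη₂ : ‖η₂‖ = 1)
    (horth : ⟪η₁, η₂⟫ = 0)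
    (A₁ A₂ : Subalgebra ℂ (H →L[ℂ] H))
    (hfree : IsFreePair (fun a => ⟪ω, a ω⟫) A₁ A₂)
    (Pi : (H →L[ℂ] H) → (FockE H J →L[ℂ] FockE H J))
    (hPi : ∀ a, IsEmbed ω a (Pi a))
    (C₁ C₂ : FockE H J →L[ℂ] FockE H J) (hC₁ : IsCre ω η₁ C₁) (hC₂ : IsCre ω η₂ C₂)
    (An₁ An₂ : ℕ → (FockE H J →L[ℂ] FockE H J))
    (hAn₁ : ∀ n, IsAnn ω η₁ n (An₁ n)) (hAn₂ : ∀ n, IsAnn ω η₂ n (An₂ n)) :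
    IsCFreePair (fockPhi J ω) (fockPsi J ω)
      (Algebra.adjoin ℂ ((Pi '' (A₁ : Set (H →L[ℂ] H))) ∪ ({C₁} ∪ Set.range An₁)))
      (Algebra.adjoin ℂ ((Pi '' (A₂ : Set (H →L[ℂ] H))) ∪ ({C₂} ∪ Set.range An₂))) := by
  have hη : Orthonormal ℂ ![η₁, η₂] := by
    rw [orthonormal_iff_ite]
    intro i j
    have h1 : ⟪η₁, η₁⟫ = 1 := inner_self_eq_one_of_norm_eq_one hη₁
    have h2 : ⟪η₂, η₂⟫ = 1 := inner_self_eq_one_of_norm_eq_one hη₂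
    have h3 : ⟪η₂, η₁⟫ = 0 := inner_eq_zero_symm.1 horth
    fin_cases i <;> fin_cases j
    · exact h1
    · exact horth
    · exact h3
    · exact h2
  have hω' : ⟪ω, ω⟫ = 1 := inner_self_eq_one_of_norm_eq_one hω
  have hC : ∀ i, IsCre ω (![η₁, η₂] i) (![C₁, C₂] i) := by
    intro i
    fin_cases i
    · exact hC₁
    · exact hC₂
  have hAn : ∀ i n, IsAnn ω (![η₁, η₂] i) n (![An₁, An₂] i n) := by
    intro i n
    fin_cases i
    · exact hAn₁ n
    · exact hAn₂ n
  have M : Model ω (tvec ![η₁, η₂] hη) (ivecL H J) Pi ![C₁, C₂] ![An₁, An₂] :=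
    { hω := hω'
      inner_t := inner_tvec _ hη
      inner_i := inner_ivec
      pi_i := fun a h => embed_ivec (hPi a) h
      pi_t := fun a u h hu => embed_tvec _ hη (hPi a) u hu h
      pi_Ω := fun a => embed_omega _ hη hω' (hPi a)
      c_i := fun i h => cre_ivec _ (hC i) h
      c_t := fun i u h => cre_tvec _ hη (hC i) u h
      an_i := fun i n h => by
        rw [ann_apply _ hη (hAn i n)]
        exact (congrArg (· • _) (inner_tvec_ivec _ hη _ _ _)).trans (zero_smul _ _)
      an_t := fun i n u h => by
        rw [ann_apply _ hη (hAn i n), inner_tvec]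
        split_ifs
        · rfl
        · rw [zero_smul] }
  have key := abstract_cfree M A₁ A₂ hfree
  have e : (fun T : FockE H J →L[ℂ] FockE H J =>
      ⟪tvec ![η₁, η₂] hη [] ω, T (tvec ![η₁, η₂] hη [] ω)⟫) = fockPhi J ω := by
    funext T
    rw [fockPhi, fockOmega_eq _ hη]
  rw [e] at key
  exact key
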